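/- For a real number θ, let S(θ) := {t ∈ ℝ : t > 0 and θ + t·i = (a·ρ + b)/(c·ρ + d) for some integers a,b,c,d with ad − bc = 1}. If θ − 1/2 is not an integer, then S(θ) has at most one element; if θ − 1/2 is an integer, then S(θ) = {√3/2, √3/6}. In particular, a vertical geodesic {θ + t·i : t > 0} passes through at most one finite corner of a PSL(2,ℤ)-translate of the standard fundamental domain, except when θ ≡ 1/2 (mod 1), in which case it passes through exactly two, at t = √3/2 and t = √3/6. -/

import Mathlib

/-- The finite corner `ρ = 1/2 + (√3/2)·i` of the standard fundamental domain of
`PSL(2,ℤ)`. -/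
noncomputable def modularCorner : ℂ := (1 + Real.sqrt 3 * Complex.I) / 2

/-- The set of heights `t > 0` at which the vertical geodesic over `θ` passes through
an `SL(2,ℤ)`-translate of the corner `ρ`. -/
noncomputable def cornerTimes (θ : ℝ) : Set ℝ :=
  {t | 0 < t ∧ ∃ a b c d : ℤ, a * d - b * c = 1 ∧
    (θ : ℂ) + t * Complex.I = ((a : ℂ) * modularCorner + b) / ((c : ℂ) * modularCorner + d)}

/-- A primitive pair `(p, q)` for which both `(p, q)` and `(3p, 3q)` extend to integral binary
quadratic forms of discriminant `-3` has `q = 1` and `p` odd. -/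
theorem eq_one_and_odd_of_sq_add_three {p q K L : ℤ} (hq : 0 < q)
    (h₁ : p ^ 2 + 3 = 4 * (q * K)) (h₃ : (3 * p) ^ 2 + 3 = 4 * (3 * q * L)) :
    q = 1 ∧ Odd p := by
  have hmul : q * (3 * K - L) = 2 := by linarith
  have hle : q ≤ 2 := Int.le_of_dvd two_pos ⟨_, hmul.symm⟩
  have hodd : Odd p := by
    by_contra h
    obtain ⟨k, rfl⟩ := Int.not_odd_iff_even.mp h
    have : 4 * (k ^ 2) + 3 = 4 * (q * K) := by linarith
    omega
  refine ⟨?_, hodd⟩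
  by_contra hne
  obtain rfl : q = 2 := by omega
  have := Int.sq_mod_four_eq_one_of_odd hodd
  obtain ⟨k, rfl⟩ := hodd
  obtain ⟨j, hj⟩ := Int.even_mul_succ_self k
  have : 4 * (k * (k + 1)) + 4 = 8 * K := by linarith
  omega

/-- A common factor of the coefficients `M` and `N` of a form of discriminant `-3`
divides `3`. -/
theorem eq_one_or_three_of_sq_add_three {g p q K : ℤ} (hg : 0 < g)
    (h : (g * p) ^ 2 + 3 = 4 * (g * q * K)) : g = 1 ∨ g = 3 := by
  have hdvd : g ∣ 3 := ⟨4 * (q * K) - g * p ^ 2, by linarith⟩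
  have hle : g ≤ 3 := Int.le_of_dvd three_pos hdvd
  interval_cases g <;> omega

/-- Two integral binary quadratic forms of discriminant `-3` whose roots have the same real
part `M / (2N)` have the same leading coefficient, unless `M / N` is an odd integer. -/
theorem eq_or_exists_odd_mul_of_sq_add_three {M N K M' N' K' : ℤ} (hN : 0 < N) (hN' : 0 < N')
    (h : M ^ 2 + 3 = 4 * (N * K)) (h' : M' ^ 2 + 3 = 4 * (N' * K'))
    (hMN : M * N' = M' * N) : N = N' ∨ ∃ m : ℤ, M = (2 * m + 1) * N := by
  obtain ⟨g, p, q, hg, hpq, rfl, rfl⟩ : ∃ g p q : ℤ, 0 < g ∧ IsCoprime q p ∧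
      M = g * p ∧ N = g * q := by
    have hpos : 0 < Int.gcd M N := Int.gcd_pos_of_ne_zero_right _ hN.ne'
    obtain ⟨p, q, hc, hp, hq⟩ := Int.exists_gcd_one hpos
    exact ⟨Int.gcd M N, p, q, by exact_mod_cast hpos,
      (Int.isCoprime_iff_gcd_eq_one.mpr hc).symm, by rw [mul_comm]; exact hp,
      by rw [mul_comm]; exact hq⟩
  have hq : 0 < q := pos_of_mul_pos_right hN hg.le
  have hcross : p * N' = M' * q :=
    mul_left_cancel₀ hg.ne' (by linarith)
  obtain ⟨g', rfl⟩ : q ∣ N' := hpq.dvd_of_dvd_mul_left ⟨M', by linarith⟩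
  obtain rfl : M' = g' * p := mul_right_cancel₀ hq.ne' (by linarith)
  have hg' : 0 < g' := pos_of_mul_pos_right hN' hq.le
  rw [mul_comm q g'] at h'
  rcases eq_one_or_three_of_sq_add_three hg h with rfl | rfl <;>
    rcases eq_one_or_three_of_sq_add_three hg' h' with rfl | rfl
  · left; ring
  · obtain ⟨rfl, m, rfl⟩ := eq_one_and_odd_of_sq_add_three hq (K := K) (by linarith) h'
    exact Or.inr ⟨m, by ring⟩
  · obtain ⟨rfl, m, rfl⟩ := eq_one_and_odd_of_sq_add_three hq (K := K') (by linarith) h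
    exact Or.inr ⟨m, by ring⟩
  · left; ring

theorem sq_add_mul_add_sq_pos {a b c d : ℤ} (h : a * d - b * c = 1) :
    0 < c ^ 2 + c * d + d ^ 2 := by
  by_contra! hle
  have hd : d = 0 := by nlinarith [sq_nonneg (2 * c + d), sq_nonneg d]
  have hc : c = 0 := by subst hd; nlinarith [sq_nonneg c]
  subst hc hd
  simp at h

theorem modularCorner_re : modularCorner.re = 1 / 2 := by
  simp [modularCorner]

theorem modularCorner_im : modularCorner.im = √3 / 2 := by
  simp [modularCorner]

/-- Real and imaginary parts of a translate of the corner by a matrix of determinant one. -/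
theorem eq_translate_modularCorner_iff {θ t : ℝ} {a b c d : ℤ} (h : a * d - b * c = 1) :
    (θ : ℂ) + t * Complex.I = ((a : ℂ) * modularCorner + b) / ((c : ℂ) * modularCorner + d) ↔
      2 * (c ^ 2 + c * d + d ^ 2 : ℤ) * θ = (2 * a * c + 2 * b * d + a * d + b * c : ℤ) ∧
        2 * (c ^ 2 + c * d + d ^ 2 : ℤ) * t = √3 := by
  have hs : (√3 : ℝ) ^ 2 = 3 := Real.sq_sqrt (by norm_num)
  have hR : (a * d - b * c : ℝ) = 1 := by exact_mod_cast h
  have hN : (0 : ℝ) < c ^ 2 + c * d + d ^ 2 := by exact_mod_cast sq_add_mul_add_sq_pos h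
  have hne : (c : ℂ) * modularCorner + d ≠ 0 := by
    intro h0
    have hre := congrArg Complex.re h0
    have him := congrArg Complex.im h0
    simp [modularCorner_re, modularCorner_im] at hre him
    have hc : (c : ℝ) = 0 := by simpa using him
    have hd : (d : ℝ) = 0 := by simpa [hc] using hre
    simp [hc, hd] at hN
  rw [eq_div_iff hne, Complex.ext_iff]
  simp [modularCorner_re, modularCorner_im]
  constructor
  · rintro ⟨hre, him⟩
    constructor
    · linear_combination (2 * d + c) * hre + √3 * c * him + (c * (a - θ * c) / 2) * hs
    · linear_combination (2 * d + c) * him - √3 * c * hre - c ^ 2 * t / 2 * hs + √3 * hR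
  · rintro ⟨hre, him⟩
    constructor
    · apply mul_left_cancel₀ hN.ne'
      linear_combination (c / 2 + d) / 2 * hre - c * √3 / 4 * him - c / 4 * hs + 3 * c / 4 * hR
    · apply mul_left_cancel₀ hN.ne'
      linear_combination c * √3 / 4 * hre + (c / 2 + d) / 2 * him - (c / 4 + d / 2) * √3 * hR

/-- A height in `cornerTimes θ` comes from an integral quadratic form of discriminant `-3`. -/
theorem exists_form_of_mem_cornerTimes {θ t : ℝ} (ht : t ∈ cornerTimes θ) :
    ∃ M N K : ℤ, 0 < N ∧ M ^ 2 + 3 = 4 * (N * K) ∧ 2 * N * θ = M ∧ 2 * N * t = √3 := by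
  obtain ⟨-, a, b, c, d, h, heq⟩ := ht
  obtain ⟨hre, him⟩ := (eq_translate_modularCorner_iff h).mp heq
  refine ⟨_, _, a ^ 2 + a * b + b ^ 2, sq_add_mul_add_sq_pos h, ?_, hre, him⟩
  linear_combination (-3 * (a * d - b * c + 1)) * h

theorem cornerTimes_subsingleton {θ : ℝ} (hθ : ¬ ∃ n : ℤ, θ - 1 / 2 = n) :
    (cornerTimes θ).Subsingleton := by
  intro t ht t' ht'
  obtain ⟨M, N, K, hN, h, hre, him⟩ := exists_form_of_mem_cornerTimes ht
  obtain ⟨M', N', K', hN', h', hre', him'⟩ := exists_form_of_mem_cornerTimes ht'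
  have hNR : (0 : ℝ) < N := by exact_mod_cast hN
  have hMN : M * N' = M' * N := by
    have : (M * N' : ℝ) = M' * N := by rw [← hre, ← hre']; ring
    exact_mod_cast this
  rcases eq_or_exists_odd_mul_of_sq_add_three hN hN' h h' hMN with rfl | ⟨m, rfl⟩
  · exact mul_left_cancel₀ (by positivity) (him.trans him'.symm)
  · refine absurd ⟨m, mul_left_cancel₀ hNR.ne' ?_⟩ hθ
    push_cast at hre
    linarith

theorem cornerTimes_intCast_add_half (n : ℤ) :
    cornerTimes (n + 1 / 2) = {√3 / 2, √3 / 6} := by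
  ext t
  simp only [Set.mem_insert_iff, Set.mem_singleton_iff]
  constructor
  · intro ht
    obtain ⟨M, N, K, hN, h, hre, him⟩ := exists_form_of_mem_cornerTimes ht
    obtain rfl : M = N * (2 * n + 1) := by
      have : (M : ℝ) = N * (2 * n + 1) := by rw [← hre]; ring
      exact_mod_cast this
    rcases eq_one_or_three_of_sq_add_three (q := 1) (K := K) hN (by rw [h, mul_one]) with rfl | rfl
    · left; push_cast at him; linarith
    · right; push_cast at him; linarith
  · rintro (rfl | rfl)
    · refine ⟨by positivity, 1, n, 0, 1, by ring,
        (eq_translate_modularCorner_iff (by ring)).mpr ⟨?_, ?_⟩⟩ <;> push_cast <;> ring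
    · refine ⟨by positivity, n + 1, n, 1, 1, by ring,
        (eq_translate_modularCorner_iff (by ring)).mpr ⟨?_, ?_⟩⟩ <;> push_cast <;> ring

/-- A vertical geodesic `{θ + t·i : t > 0}` passes through at most one finite corner of a
`PSL(2,ℤ)`-translate of the standard fundamental domain, except when `θ ≡ 1/2 (mod 1)`,
in which case it passes through exactly two, at `t = √3/2` and `t = √3/6`. -/
theorem vertical_geodesic_corner_count (θ : ℝ) :
    ((¬ ∃ n : ℤ, θ - 1 / 2 = n) → (cornerTimes θ).Subsingleton) ∧
    ((∃ n : ℤ, θ - 1 / 2 = n) →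
      cornerTimes θ = {Real.sqrt 3 / 2, Real.sqrt 3 / 6}) := by
  refine ⟨cornerTimes_subsingleton, ?_⟩
  rintro ⟨n, hn⟩
  rw [← cornerTimes_intCast_add_half n, ← hn, sub_add_cancel]
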